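/- Let k ≥ 1. Let A be a real k×(2k+1) matrix of rank k with A·Ω₀⁽²ᵏ⁺¹⁾·Aᵀ = 0 all of whose k×k minors are nonnegative. Then there exist a real (k+1)×(2k+2) matrix B of rank k+1 with B·Ω₀⁽²ᵏ⁺²⁾·Bᵀ = 0 all of whose (k+1)×(k+1) minors are nonnegative, and a nonzero real number c, such that for every k-element subset I of {1,…,2k+1}, p_{I∪{2k+2}}(B) = c · p_I(A). Together with the converse direction, this shows the assignment p_I = q_{I∪{2k+2}} is a linear isomorphism identifying OGr₊(k, 2k+1) with OGr₊(k+1, 2k+2). -/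

import Mathlib

open Matrix

/-- The Plücker coordinate `p_I(A)` of a `k × n` matrix `A`: the determinant of the
`k × k` submatrix of `A` whose columns are indexed by `I`, taken in increasing order.
(Defined to be `0` when `I` does not have exactly `k` elements.) -/
noncomputable def plucker {R : Type} [CommRing R] {k n : ℕ}
    (A : Matrix (Fin k) (Fin n) R) (I : Finset (Fin n)) : R :=
  if h : I.card = k then
    (Matrix.of fun (i : Fin k) (j : Fin k) => A i (I.orderEmbOfFin h j)).det
  else 0

/-- The `m × m` diagonal matrix `Ω₀` of the alternating form
`ω₀(x, y) = ∑ᵢ (-1)^{i-1} xᵢ yᵢ` (zero-based: diagonal entries `(-1)^i`). -/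
def Omega0 (m : ℕ) : Matrix (Fin m) (Fin m) ℝ :=
  Matrix.diagonal fun i : Fin m => (-1 : ℝ) ^ (i : ℕ)

/-- The permutation sorting a block `s` of size `m` before its complement has a sign determined,
up to a constant, by the parity of the sum of the elements of the complement. -/
theorem sign_finSumEquivOfFinset {m n : ℕ} (s : Finset (Fin (m + n)))
    (hm : s.card = m) (hn : sᶜ.card = n) :
    (Equiv.Perm.sign (finSumFinEquiv.symm.trans (finSumEquivOfFinset hm hn)) : ℤ) =
      ∏ b : Fin n, ((-1) ^ m * (-1) ^ (b : ℕ) * (-1) ^ (sᶜ.orderEmbOfFin hn b : ℕ)) := by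
  have hcount : ∀ {N : ℕ} (i : Fin N), (∏ x : Fin N, if x < i then (-1 : ℤ) else 1) =
      (-1) ^ (i : ℕ) := by
    intro N i
    rw [Finset.prod_ite, Finset.prod_const_one, mul_one, Finset.prod_const, ← Fin.card_Iio i]
    congr 2
    ext j; simp
  have hsplit : ∀ b : Fin n,
      (∏ a : Fin m, if s.orderEmbOfFin hm a < sᶜ.orderEmbOfFin hn b then (-1 : ℤ) else 1) *
        (-1) ^ (b : ℕ) = (-1) ^ (sᶜ.orderEmbOfFin hn b : ℕ) := by
    intro b
    rw [← hcount (sᶜ.orderEmbOfFin hn b), ← hcount b,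
      ← Equiv.prod_comp (finSumEquivOfFinset hm hn), Fintype.prod_sum_type]
    simp only [finSumEquivOfFinset_inl, finSumEquivOfFinset_inr, OrderEmbedding.lt_iff_lt]
    congr!
  have hrow : ∀ b : Fin n,
      (∏ a : Fin m, if s.orderEmbOfFin hm a < sᶜ.orderEmbOfFin hn b then (1 : ℤ) else -1) =
        (-1) ^ m * (-1) ^ (b : ℕ) * (-1) ^ (sᶜ.orderEmbOfFin hn b : ℕ) := by
    intro b
    have hneg : ∀ a : Fin m,
        (if s.orderEmbOfFin hm a < sᶜ.orderEmbOfFin hn b then (1 : ℤ) else -1) =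
        -1 * (if s.orderEmbOfFin hm a < sᶜ.orderEmbOfFin hn b then (-1 : ℤ) else 1) := by
      intro a; split_ifs <;> simp
    have hb : ((-1 : ℤ) ^ (b : ℕ)) * (-1) ^ (b : ℕ) = 1 := by
      rw [← mul_pow]; simp
    rw [Finset.prod_congr rfl fun a _ => hneg a, Finset.prod_mul_distrib, ← hsplit b]
    simp only [Finset.prod_const, Finset.card_univ, Fintype.card_fin]
    linear_combination (-(-1 : ℤ) ^ m *
      ∏ a : Fin m, if s.orderEmbOfFin hm a < sᶜ.orderEmbOfFin hn b then (-1 : ℤ) else 1) * hb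
  have hIoi : ∀ (i : Fin (m + n)) (f : Fin (m + n) → ℤ),
      ∏ j ∈ Finset.Ioi i, f j = ∏ j, if i < j then f j else 1 := by
    intro i f
    rw [Finset.prod_ite, Finset.prod_const_one, mul_one]
    congr 1
    ext j; simp
  rw [← Finset.prod_congr rfl fun b _ => hrow b, Finset.prod_comm, Equiv.Perm.sign_eq_prod_prod_Ioi]
  push_cast
  simp only [hIoi, Fin.prod_univ_add]
  have hlr : ∀ (a : Fin m) (b : Fin n), Fin.castAdd n a < Fin.natAdd m b := by
    intro a b; simp only [Fin.lt_def, Fin.val_castAdd, Fin.val_natAdd]; omega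
  have hone : ∀ {l : ℕ} (a a' : Fin l),
      (if a < a' then (((if a < a' then 1 else -1 : ℤˣ) : ℤˣ) : ℤ) else 1) = 1 := by
    intro l a a'
    split_ifs <;> rfl
  have hcast : ∀ a a' : Fin m, (Fin.castAdd n a < Fin.castAdd n a') = (a < a') := fun _ _ => rfl
  simp [hlr, (hlr _ _).not_gt, hcast, hone]
  push_cast [apply_ite]
  rfl

theorem Matrix.rank_eq_height_iff {K : Type*} [Field K] {k n : ℕ} (M : Matrix (Fin k) (Fin n) K) :
    M.rank = k ↔ ∀ v, v ᵥ* M = 0 → v = 0 := by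
  rw [Matrix.rank_eq_finrank_span_row]
  have h₁ := linearIndependent_iff_card_eq_finrank_span (R := K) (b := M.row)
  rw [Fintype.card_fin, Set.finrank] at h₁
  rw [eq_comm]
  refine h₁.symm.trans (Matrix.vecMul_injective_iff.symm.trans ?_)
  exact injective_iff_map_eq_zero M.vecMulLinear

theorem Matrix.det_mul_transpose_ne_zero {k n : ℕ} {M : Matrix (Fin k) (Fin n) ℝ}
    (hM : M.rank = k) : (M * Mᵀ).det ≠ 0 := by
  rw [← Matrix.rank_self_mul_transpose, Matrix.rank_eq_height_iff] at hM
  intro h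
  obtain ⟨v, hv, hv'⟩ := Matrix.exists_vecMul_eq_zero_iff.2 h
  exact hv (hM v hv')

theorem plucker_eq_det_submatrix {R : Type} [CommRing R] {k n : ℕ} (A : Matrix (Fin k) (Fin n) R)
    {I : Finset (Fin n)} (h : I.card = k) :
    plucker A I = (A.submatrix id (I.orderEmbOfFin h)).det := by
  rw [plucker, dif_pos h]; rfl

/-- The maximal minors of two matrices spanning `ω₀`-orthogonal complementary subspaces are
proportional under complementation of the column set. -/
theorem exists_plucker_eq_mul_plucker_compl {m n N : ℕ} {C : Matrix (Fin m) (Fin N) ℝ}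
    {A : Matrix (Fin n) (Fin N) ℝ} (hC : C.rank = m) (hA : A.rank = n) (hN : N = m + n)
    (h : C * Omega0 N * Aᵀ = 0) :
    ∃ r : ℝ, ∀ J : Finset (Fin N), J.card = m →
      plucker C J = r * plucker A Jᶜ := by
  subst hN
  set D := A * Omega0 (m + n) with hD
  have hΩ : (Omega0 (m + n))ᵀ = Omega0 (m + n) := Matrix.diagonal_transpose _
  have hΩΩ : Omega0 (m + n) * Omega0 (m + n) = 1 := by
    rw [Omega0, Matrix.diagonal_mul_diagonal, ← Matrix.diagonal_one]
    congr 1; ext i; rw [← mul_pow]; simp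
  have hCD : C * Dᵀ = 0 := by
    rw [hD, Matrix.transpose_mul, hΩ, ← Matrix.mul_assoc, h]
  have hDC : D * Cᵀ = 0 := by
    rw [← Matrix.transpose_transpose D, ← Matrix.transpose_mul, hCD, Matrix.transpose_zero]
  have hDD : D * Dᵀ = A * Aᵀ := by
    rw [hD, Matrix.transpose_mul, hΩ, Matrix.mul_assoc, ← Matrix.mul_assoc (Omega0 _), hΩΩ,
      Matrix.one_mul]
  let P : Matrix (Fin (m + n)) (Fin m ⊕ Fin n) ℝ := Matrix.fromCols Cᵀ Dᵀ
  have hdetCC := Matrix.det_mul_transpose_ne_zero hC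
  have hdetDD : (D * Dᵀ).det ≠ 0 := hDD ▸ Matrix.det_mul_transpose_ne_zero hA
  set d := (P.submatrix finSumFinEquiv id).det with hd
  have hd0 : d ≠ 0 := by
    have hPP : (P.submatrix finSumFinEquiv id)ᵀ * P.submatrix finSumFinEquiv id =
        Matrix.fromBlocks (C * Cᵀ) 0 0 (D * Dᵀ) := by
      rw [Matrix.transpose_submatrix, Matrix.submatrix_mul_equiv, Matrix.submatrix_id_id,
        Matrix.transpose_fromCols, Matrix.transpose_transpose, Matrix.transpose_transpose,
        Matrix.fromRows_mul_fromCols, hCD, hDC]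
    intro h0
    have := congrArg Matrix.det hPP
    rw [Matrix.det_mul, ← hd, h0, mul_zero, Matrix.det_fromBlocks_zero₂₁] at this
    exact mul_ne_zero hdetCC hdetDD this.symm
  let ε : ℝ := ∏ b : Fin n, ((-1) ^ m * (-1) ^ (b : ℕ))
  have hε : ε * ε = 1 := by
    simp only [ε, ← Finset.prod_mul_distrib]
    refine Finset.prod_eq_one fun b _ => ?_
    rw [← pow_add, ← mul_pow]; simp
  have hε0 : ε ≠ 0 := left_ne_zero_of_mul_eq_one hε
  refine ⟨(C * Cᵀ).det / (ε * d), fun J hJ => ?_⟩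
  have hJc : Jᶜ.card = n := by
    rw [Finset.card_compl, hJ, Fintype.card_fin]; omega
  let e := finSumEquivOfFinset hJ hJc
  let δ : ℝ := ∏ b : Fin n, (-1) ^ (Jᶜ.orderEmbOfFin hJc b : ℕ)
  have hδ : δ * δ = 1 := by
    simp only [δ, ← Finset.prod_mul_distrib]
    refine Finset.prod_eq_one fun b _ => ?_
    rw [← mul_pow]; simp
  have hPe : (P.submatrix e id).det = ε * δ * d := by
    have h₁ : P.submatrix e id = ((P.submatrix finSumFinEquiv id).submatrix
        (finSumFinEquiv.trans ((finSumFinEquiv.symm.trans e).trans finSumFinEquiv.symm)) id) := by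
      ext i j; simp
    rw [h₁, Matrix.det_permute, ← hd]
    have h₂ : Equiv.Perm.sign (finSumFinEquiv.trans
        ((finSumFinEquiv.symm.trans e).trans finSumFinEquiv.symm)) =
        Equiv.Perm.sign (finSumFinEquiv.symm.trans e) :=
      Equiv.Perm.sign_symm_trans_trans (finSumFinEquiv.symm.trans e) finSumFinEquiv.symm
    rw [h₂]
    have h₃ := congrArg (Int.cast : ℤ → ℝ) (sign_finSumEquivOfFinset J hJ hJc)
    rw [Finset.prod_mul_distrib] at h₃
    push_cast at h₃
    rw [h₃]
  let G : Matrix (Fin m ⊕ Fin n) (Fin m ⊕ Fin n) ℝ :=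
    Matrix.fromBlocks (C.submatrix id (J.orderEmbOfFin hJ))
      (C.submatrix id (Jᶜ.orderEmbOfFin hJc)) 0 1
  have hPblock : P.submatrix e id = Matrix.fromBlocks
      (Cᵀ.submatrix (J.orderEmbOfFin hJ) id) (Dᵀ.submatrix (J.orderEmbOfFin hJ) id)
      (Cᵀ.submatrix (Jᶜ.orderEmbOfFin hJc) id) (Dᵀ.submatrix (Jᶜ.orderEmbOfFin hJc) id) := by
    ext (i | i) (j | j) <;> rfl
  have hsum : ∀ {l : ℕ} (M : Matrix (Fin (m + n)) (Fin l) ℝ),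
      C.submatrix id (J.orderEmbOfFin hJ) * M.submatrix (J.orderEmbOfFin hJ) id +
        C.submatrix id (Jᶜ.orderEmbOfFin hJc) * M.submatrix (Jᶜ.orderEmbOfFin hJc) id =
      C * M := by
    intro l M
    ext i j
    simp only [Matrix.add_apply, Matrix.mul_apply]
    rw [← Equiv.sum_comp e, Fintype.sum_sum_type]
    rfl
  have hGP : G * P.submatrix e id = Matrix.fromBlocks (C * Cᵀ) 0
      (Cᵀ.submatrix (Jᶜ.orderEmbOfFin hJc) id) (Dᵀ.submatrix (Jᶜ.orderEmbOfFin hJc) id) := by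
    rw [hPblock, Matrix.fromBlocks_multiply, hsum, hsum, hCD]
    simp
  have hDA : (Dᵀ.submatrix (Jᶜ.orderEmbOfFin hJc) id).det = δ * plucker A Jᶜ := by
    have h₁ : Dᵀ.submatrix (Jᶜ.orderEmbOfFin hJc) id =
        Matrix.diagonal (fun b : Fin n => (-1 : ℝ) ^ (Jᶜ.orderEmbOfFin hJc b : ℕ)) *
          (A.submatrix id (Jᶜ.orderEmbOfFin hJc))ᵀ := by
      ext i j
      simp [hD, Omega0, Matrix.diagonal_mul, mul_comm]
    rw [h₁, Matrix.det_mul, Matrix.det_diagonal, Matrix.det_transpose,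
      plucker_eq_det_submatrix A hJc]
  have hdet := congrArg Matrix.det hGP
  rw [Matrix.det_mul, hPe, Matrix.det_fromBlocks_zero₁₂, hDA, Matrix.det_fromBlocks_zero₂₁,
    Matrix.det_one, mul_one, ← plucker_eq_det_submatrix C hJ] at hdet
  field_simp
  linear_combination δ * hdet + ((C * Cᵀ).det * plucker A Jᶜ - plucker C J * ε * d) * hδ

/-- The `ω₀`-orthogonal complement of `k` vectors in `ℝ^(2k+1)` contains a vector `w` with
`ω₀(w, w) = 1`. -/
theorem exists_orthogonal_unit {k : ℕ} (A : Matrix (Fin k) (Fin (2 * k + 1)) ℝ) :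
    ∃ w : Fin (2 * k + 1) → ℝ, (∀ i, ∑ l, A i l * (-1) ^ (l : ℕ) * w l = 0) ∧
      ∑ l, w l * (-1) ^ (l : ℕ) * w l = 1 := by
  let f : (Fin (2 * k + 1) → ℝ) →ₗ[ℝ] (Fin k → ℝ) × (Fin k → ℝ) :=
    (A * Omega0 (2 * k + 1)).mulVecLin.prod
      (LinearMap.funLeft ℝ ℝ fun j : Fin k => (⟨2 * j + 1, by omega⟩ : Fin (2 * k + 1)))
  have hf : LinearMap.ker f ≠ ⊥ := LinearMap.ker_ne_bot_of_finrank_lt (by simp; omega)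
  obtain ⟨x, hx, hx0⟩ := (Submodule.ne_bot_iff _).1 hf
  obtain ⟨hx₁, hx₂⟩ := Prod.mk.inj (LinearMap.mem_ker.1 hx)
  have horth : ∀ i, ∑ l, A i l * (-1) ^ (l : ℕ) * x l = 0 := by
    intro i
    have h : ((A * Omega0 (2 * k + 1)) *ᵥ x) i = 0 := congrFun hx₁ i
    simpa [Matrix.mulVec, dotProduct, Omega0, Matrix.mul_diagonal] using h
  have hodd : ∀ l : Fin (2 * k + 1), x l * (-1) ^ (l : ℕ) * x l = x l ^ 2 := by
    intro l
    rcases Nat.even_or_odd' (l : ℕ) with ⟨j, hj | hj⟩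
    · rw [hj, pow_mul]; simp; ring
    · have : x l = 0 := by
        have hl : l = ⟨2 * (⟨j, by omega⟩ : Fin k) + 1, by dsimp; omega⟩ := Fin.ext hj
        rw [hl]
        exact congrFun hx₂ ⟨j, by omega⟩
      simp [this]
  set q := ∑ l, x l ^ 2 with hq
  have hq0 : 0 < q := by
    obtain ⟨l, hl⟩ := Function.ne_iff.1 hx0
    exact Finset.sum_pos' (fun _ _ => sq_nonneg _) ⟨l, Finset.mem_univ l, by
      have : x l ≠ 0 := hl
      positivity⟩
  refine ⟨fun l => (√q)⁻¹ * x l, fun i => ?_, ?_⟩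
  · rw [← mul_zero (√q)⁻¹, ← horth i, Finset.mul_sum]
    exact Finset.sum_congr rfl fun l _ => by ring
  · have : ∀ l, (√q)⁻¹ * x l * (-1) ^ (l : ℕ) * ((√q)⁻¹ * x l) = q⁻¹ * x l ^ 2 := by
      intro l
      rw [← hodd l]
      have : (√q)⁻¹ * (√q)⁻¹ = q⁻¹ := by rw [← mul_inv, Real.mul_self_sqrt hq0.le]
      linear_combination (x l * (-1) ^ (l : ℕ) * x l) * this
    rw [Finset.sum_congr rfl fun l _ => this l, ← Finset.mul_sum, ← hq, inv_mul_cancel₀ hq0.ne']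

/-- The matrix `A` with an additional last row `w`. -/
def Matrix.snocRow {R : Type*} {k n : ℕ} (A : Matrix (Fin k) (Fin n) R) (w : Fin n → R) :
    Matrix (Fin (k + 1)) (Fin n) R :=
  Matrix.of fun i j => Fin.lastCases (motive := fun _ => R) (w j) (fun i => A i j) i

@[simp]
theorem Matrix.snocRow_last {R : Type*} {k n : ℕ} (A : Matrix (Fin k) (Fin n) R) (w : Fin n → R)
    (j : Fin n) : A.snocRow w (Fin.last k) j = w j := by
  simp [Matrix.snocRow]

@[simp]
theorem Matrix.snocRow_castSucc {R : Type*} {k n : ℕ} (A : Matrix (Fin k) (Fin n) R)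
    (w : Fin n → R) (i : Fin k) (j : Fin n) : A.snocRow w i.castSucc j = A i j := by
  simp [Matrix.snocRow]

/-- The block matrix `[A, 0; w, 1]`. -/
def Matrix.border {R : Type*} [Zero R] [One R] {k n : ℕ} (A : Matrix (Fin k) (Fin n) R)
    (w : Fin n → R) : Matrix (Fin (k + 1)) (Fin (n + 1)) R :=
  ((Aᵀ.snocRow 0)ᵀ).snocRow (Fin.snoc w 1)

@[simp]
theorem Matrix.border_castSucc_castSucc {R : Type*} [Zero R] [One R] {k n : ℕ}
    (A : Matrix (Fin k) (Fin n) R) (w : Fin n → R) (i : Fin k) (j : Fin n) :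
    A.border w i.castSucc j.castSucc = A i j := by
  simp [Matrix.border]

@[simp]
theorem Matrix.border_castSucc_last {R : Type*} [Zero R] [One R] {k n : ℕ}
    (A : Matrix (Fin k) (Fin n) R) (w : Fin n → R) (i : Fin k) :
    A.border w i.castSucc (Fin.last n) = 0 := by
  simp [Matrix.border]

@[simp]
theorem Matrix.border_last_castSucc {R : Type*} [Zero R] [One R] {k n : ℕ}
    (A : Matrix (Fin k) (Fin n) R) (w : Fin n → R) (j : Fin n) :
    A.border w (Fin.last k) j.castSucc = w j := by
  simp [Matrix.border]

@[simp]
theorem Matrix.border_last_last {R : Type*} [Zero R] [One R] {k n : ℕ}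
    (A : Matrix (Fin k) (Fin n) R) (w : Fin n → R) :
    A.border w (Fin.last k) (Fin.last n) = 1 := by
  simp [Matrix.border]

theorem plucker_border_insert_last {R : Type} [CommRing R] {k n : ℕ}
    (A : Matrix (Fin k) (Fin n) R) (w : Fin n → R) {I : Finset (Fin n)} (hI : I.card = k) :
    plucker (A.border w) (insert (Fin.last n) (I.map Fin.castSuccEmb)) = plucker A I := by
  have hcard : (insert (Fin.last n) (I.map Fin.castSuccEmb)).card = k + 1 := by
    rw [Finset.card_insert_of_notMem (by simp [Fin.castSucc_ne_last]), Finset.card_map, hI]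
  let f : Fin (k + 1) → Fin (n + 1) :=
    Fin.lastCases (Fin.last n) fun i => (I.orderEmbOfFin hI i).castSucc
  have hemb : f = (insert (Fin.last n) (I.map Fin.castSuccEmb)).orderEmbOfFin hcard := by
    refine Finset.orderEmbOfFin_unique hcard (fun i => ?_) ?_
    · refine Fin.lastCases ?_ (fun i => ?_) i <;> simp [f]
    · intro i j
      refine Fin.lastCases ?_ (fun i => ?_) i <;> refine Fin.lastCases ?_ (fun j => ?_) j <;>
        simp [f, Fin.castSucc_lt_last, Fin.le_last]
  rw [plucker_eq_det_submatrix _ hcard, plucker_eq_det_submatrix _ hI, ← hemb,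
    Matrix.det_succ_column _ (Fin.last k), Fin.sum_univ_castSucc]
  have hsub : ((A.border w).submatrix id f).submatrix (Fin.last k).succAbove
      (Fin.last k).succAbove = A.submatrix id (I.orderEmbOfFin hI) := by
    ext i j
    simp [f]
  rw [hsub]
  simp [f, ← two_mul]

theorem plucker_border_map_castSucc {R : Type} [CommRing R] {k n : ℕ}
    (A : Matrix (Fin k) (Fin n) R) (w : Fin n → R) {I : Finset (Fin n)} (hI : I.card = k + 1) :
    plucker (A.border w) (I.map Fin.castSuccEmb) = plucker (A.snocRow w) I := by
  have hcard : (I.map Fin.castSuccEmb).card = k + 1 := by rw [Finset.card_map, hI]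
  have hemb : (fun i => (I.orderEmbOfFin hI i).castSucc) =
      (I.map Fin.castSuccEmb).orderEmbOfFin hcard :=
    Finset.orderEmbOfFin_unique hcard (fun i => by simp) fun i j h => by simpa using h
  rw [plucker_eq_det_submatrix _ hcard, plucker_eq_det_submatrix _ hI, ← hemb]
  congr 1
  ext i j
  refine Fin.lastCases ?_ (fun i => ?_) i <;> simp

theorem plucker_snocRow_smul {R : Type} [CommRing R] {k n : ℕ} (A : Matrix (Fin k) (Fin n) R)
    (w : Fin n → R) (s : R) {I : Finset (Fin n)} (hI : I.card = k + 1) :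
    plucker (A.snocRow (s • w)) I = s * plucker (A.snocRow w) I := by
  rw [plucker_eq_det_submatrix _ hI, plucker_eq_det_submatrix _ hI]
  let v : Fin (k + 1) → R := Fin.lastCases s fun _ => 1
  have hv : ∏ i, v i = s := by simp [v, Fin.prod_univ_castSucc]
  rw [← hv, ← Matrix.det_mul_column, hv]
  congr 1
  ext i j
  refine Fin.lastCases ?_ (fun i => ?_) i <;> simp [v]

theorem Matrix.mul_Omega0_mul_transpose_apply {k l n : ℕ} (M : Matrix (Fin k) (Fin n) ℝ)
    (N : Matrix (Fin l) (Fin n) ℝ) (i : Fin k) (j : Fin l) :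
    (M * Omega0 n * Nᵀ) i j = ∑ x, M i x * (-1) ^ (x : ℕ) * N j x := by
  rw [Matrix.mul_apply]
  simp [Omega0, Matrix.mul_diagonal]

theorem Matrix.rank_border {K : Type*} [Field K] {k n : ℕ} {A : Matrix (Fin k) (Fin n) K}
    (hA : A.rank = k) (w : Fin n → K) : (A.border w).rank = k + 1 := by
  rw [Matrix.rank_eq_height_iff] at hA ⊢
  intro v hv
  have hlast : v (Fin.last k) = 0 := by
    have := congrFun hv (Fin.last n)
    simpa [Matrix.vecMul, dotProduct, Fin.sum_univ_castSucc] using this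
  have hinit := hA (fun i => v i.castSucc) <| by
    ext j
    have := congrFun hv j.castSucc
    simpa [Matrix.vecMul, dotProduct, Fin.sum_univ_castSucc, hlast] using this
  ext i
  refine Fin.lastCases hlast (fun i => congrFun hinit i) i

theorem exists_sign_plucker_snocRow_nonneg {k : ℕ}
    {A : Matrix (Fin k) (Fin (2 * k + 1)) ℝ} (hrank : A.rank = k)
    (hA : A * Omega0 (2 * k + 1) * Aᵀ = 0)
    (hpos : ∀ I : Finset (Fin (2 * k + 1)), I.card = k → 0 ≤ plucker A I)
    {w : Fin (2 * k + 1) → ℝ} (hw : ∀ i, ∑ l, A i l * (-1) ^ (l : ℕ) * w l = 0)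
    (hww : ∑ l, w l * (-1) ^ (l : ℕ) * w l = 1) :
    ∃ s : ℝ, s * s = 1 ∧ ∀ J : Finset (Fin (2 * k + 1)), J.card = k + 1 →
      0 ≤ plucker (A.snocRow (s • w)) J := by
  have hw' : ∀ i, ∑ l, w l * (-1) ^ (l : ℕ) * A i l = 0 := fun i =>
    (Finset.sum_congr rfl fun l _ => by ring).trans (hw i)
  have hC : (A.snocRow w).rank = k + 1 := by
    rw [Matrix.rank_eq_height_iff] at hrank ⊢
    intro v hv
    have hcomb : ∀ l, ∑ i : Fin k, v i.castSucc * A i l + v (Fin.last k) * w l = 0 := by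
      intro l
      have := congrFun hv l
      simpa [Matrix.vecMul, dotProduct, Fin.sum_univ_castSucc] using this
    have hlast : v (Fin.last k) = 0 := by
      have h₁ : ∑ l, (∑ i : Fin k, v i.castSucc * A i l + v (Fin.last k) * w l) *
          ((-1) ^ (l : ℕ) * w l) = 0 := Finset.sum_eq_zero fun l _ => by rw [hcomb, zero_mul]
      have h₂ : ∑ l, (∑ i : Fin k, v i.castSucc * A i l + v (Fin.last k) * w l) *
          ((-1) ^ (l : ℕ) * w l) =
          ∑ i : Fin k, v i.castSucc * ∑ l, A i l * (-1) ^ (l : ℕ) * w l +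
            v (Fin.last k) * ∑ l, w l * (-1) ^ (l : ℕ) * w l := by
        simp only [add_mul, Finset.sum_add_distrib, Finset.sum_mul, Finset.mul_sum]
        rw [Finset.sum_comm]
        simp only [mul_assoc]
      simpa [hw, hww, h₁] using h₂.symm
    have hinit := hrank (fun i => v i.castSucc) <| by
      ext l
      simpa [Matrix.vecMul, dotProduct, hlast] using hcomb l
    ext i
    refine Fin.lastCases hlast (fun i => congrFun hinit i) i
  have horth : A.snocRow w * Omega0 (2 * k + 1) * Aᵀ = 0 := by
    ext i j
    rw [Matrix.mul_Omega0_mul_transpose_apply]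
    refine Fin.lastCases ?_ (fun i => ?_) i
    · simpa using hw' j
    · have := congrFun (congrFun hA i) j
      rw [Matrix.mul_Omega0_mul_transpose_apply] at this
      simpa using this
  obtain ⟨r, hr⟩ := exists_plucker_eq_mul_plucker_compl hC hrank (by omega) horth
  have hcompl : ∀ J : Finset (Fin (2 * k + 1)), J.card = k + 1 → 0 ≤ plucker A Jᶜ := by
    intro J hJ
    apply hpos
    rw [Finset.card_compl, hJ, Fintype.card_fin]
    omega
  rcases le_total 0 r with h | h
  · refine ⟨1, one_mul 1, fun J hJ => ?_⟩
    rw [one_smul, hr J hJ]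
    exact mul_nonneg h (hcompl J hJ)
  · refine ⟨-1, by norm_num, fun J hJ => ?_⟩
    rw [plucker_snocRow_smul A w (-1) hJ, hr J hJ, neg_one_mul, ← neg_mul]
    exact mul_nonneg (neg_nonneg.2 h) (hcompl J hJ)

/-- Let `A` be a real `k × (2k+1)` matrix of rank `k` with
`A * Ω₀ * Aᵀ = 0` all of whose maximal minors are nonnegative.  Then there are a real
`(k+1) × (2k+2)` matrix `B` of rank `k + 1` with `B * Ω₀ * Bᵀ = 0`, all of whose
maximal minors are nonnegative, and a nonzero real `c`, such that
`p_{I∪{2k+2}}(B) = c · p_I(A)` for every `k`-element subset `I` of `{1, …, 2k+1}`.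
(Together with the converse direction this identifies `OGr₊(k, 2k+1)` with
`OGr₊(k+1, 2k+2)` via the linear map `p_I = q_{I∪{2k+2}}`.) -/
theorem statement16 {k : ℕ} (hk : 1 ≤ k)
    (A : Matrix (Fin k) (Fin (2 * k + 1)) ℝ) (hrank : A.rank = k)
    (hA : A * Omega0 (2 * k + 1) * Aᵀ = 0)
    (hpos : ∀ I : Finset (Fin (2 * k + 1)), I.card = k → 0 ≤ plucker A I) :
    ∃ (B : Matrix (Fin (k + 1)) (Fin (2 * k + 2)) ℝ) (c : ℝ), B.rank = k + 1 ∧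
      B * Omega0 (2 * k + 2) * Bᵀ = 0 ∧
      (∀ J : Finset (Fin (2 * k + 2)), J.card = k + 1 → 0 ≤ plucker B J) ∧ c ≠ 0 ∧
      ∀ I : Finset (Fin (2 * k + 1)), I.card = k →
        plucker B (insert (Fin.last (2 * k + 1)) (I.map Fin.castSuccEmb)) =
          c * plucker A I := by
  obtain ⟨w, hw, hww⟩ := exists_orthogonal_unit A
  obtain ⟨s, hs, hJ⟩ := exists_sign_plucker_snocRow_nonneg hrank hA hpos hw hww
  have hAA : ∀ i j, ∑ l, A i l * (-1) ^ (l : ℕ) * A j l = 0 := fun i j => by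
    rw [← Matrix.mul_Omega0_mul_transpose_apply, hA, Matrix.zero_apply]
  have hAw : ∀ i, ∑ l, A i l * (-1) ^ (l : ℕ) * (s * w l) = 0 := fun i => by
    rw [← mul_zero s, ← hw i, Finset.mul_sum]
    exact Finset.sum_congr rfl fun l _ => by ring
  have hwA : ∀ i, ∑ l, s * w l * (-1) ^ (l : ℕ) * A i l = 0 := fun i =>
    (Finset.sum_congr rfl fun l _ => by ring).trans (hAw i)
  have hsww : ∑ l, s * w l * (-1) ^ (l : ℕ) * (s * w l) = 1 :=
    (Finset.sum_congr rfl fun l _ => by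
      linear_combination (w l * (-1) ^ (l : ℕ) * w l) * hs).trans hww
  refine ⟨A.border (s • w), 1, Matrix.rank_border hrank _, ?_, fun J hcard => ?_, one_ne_zero,
    fun I hI => by rw [one_mul, plucker_border_insert_last A _ hI]⟩
  · ext i j
    rw [Matrix.mul_Omega0_mul_transpose_apply, Fin.sum_univ_castSucc]
    refine Fin.lastCases ?_ (fun i => ?_) i <;> refine Fin.lastCases ?_ (fun j => ?_) j <;>
      simp [hAA, hAw, hwA, hsww, pow_succ, pow_mul]
  · have hinj := (Fin.castSucc_injective (2 * k + 1)).injOn (s := Fin.castSucc ⁻¹' (J : Set _))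
    let I := J.preimage Fin.castSucc hinj
    by_cases hlast : Fin.last (2 * k + 1) ∈ J
    · have hJI : J = insert (Fin.last (2 * k + 1)) (I.map Fin.castSuccEmb) := by
        ext x
        refine Fin.lastCases ?_ (fun x => ?_) x <;> simp [I, hlast, Fin.castSucc_ne_last]
      have hI : I.card = k := by
        rw [hJI, Finset.card_insert_of_notMem (by simp [Fin.castSucc_ne_last]),
          Finset.card_map] at hcard
        omega
      rw [hJI, plucker_border_insert_last A _ hI]
      exact hpos I hI
    · have hJI : J = I.map Fin.castSuccEmb := by
        ext x
        refine Fin.lastCases ?_ (fun x => ?_) x <;> simp [I, hlast, Fin.castSucc_ne_last]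
      have hI : I.card = k + 1 := by rwa [hJI, Finset.card_map] at hcard
      rw [hJI, plucker_border_map_castSucc A _ hI]
      exact hJ I hI
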